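/- Let h > 0, r ≥ 1, n ∈ ℤ, and θ ∈ (1/8, 3/8). Then there exists ρ > 0 with the following property. For every Hermitian infinite matrix M : ℤ × ℤ → ℂ (M_{jl} = conj(M_{lj})) with ‖M‖_r := sup_j Σ_l |M_{jl}|·⟨j−l⟩^r < ρ, there exists an infinite matrix T : ℤ × ℤ → ℂ such that: (i) T is anti-Hermitian, T_{jk} = −conj(T_{kj}); (ii) T_{jk} = 0 unless exactly one of j, k equals n; (iii) ‖T‖_r := sup_j Σ_l |T_{jl}|·⟨j−l⟩^r < ∞; and (iv) defining matrix powers by (T^{(1)}) = T and (T^{(m+1)})_{jk} = Σ_l (T^{(m)})_{jl}·T_{lk}, the exponentials (Exp(±T))_{jk} := δ_{jk} + Σ_{m≥1} ((±T)^{(m)})_{jk}/m!, and the conjugated matrix C_{jk} := Σ_{l∈ℤ} (Exp(−T))_{jl}·g_θ(l)·(Exp(T))_{lk} + Σ_{l∈ℤ} Σ_{m∈ℤ} (Exp(−T))_{jl}·M_{lm}·(Exp(T))_{mk}, one has C_{jn} = 0 for all j ≠ n and C_{nk} = 0 for all k ≠ n. -/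

import Mathlib

open scoped ENNReal

/-- The Japanese bracket `⟨m⟩ = √(2(m² + 1))` of an integer `m`. -/
noncomputable def bracket (m : ℤ) : ℝ := Real.sqrt (2 * ((m : ℝ) ^ 2 + 1))

/-- The flat-bottom dispersion function `g_θ(k) = (k + θ)·tanh(h·(k + θ))`. -/
noncomputable def dispersion (h θ : ℝ) (k : ℤ) : ℝ :=
  ((k : ℝ) + θ) * Real.tanh (h * ((k : ℝ) + θ))

/-- Iterated matrix powers: `matPow T m` is the `(m+1)`-st power `T^{(m+1)}` of the
infinite matrix `T`, defined by `T^{(1)} = T` and `(T^{(m+1)})_{jk} = Σ_l (T^{(m)})_{jl}T_{lk}`. -/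
noncomputable def matPow (T : ℤ → ℤ → ℂ) : ℕ → ℤ → ℤ → ℂ
  | 0 => T
  | m + 1 => fun j k => ∑' l : ℤ, matPow T m j l * T l k

/-- The matrix exponential `(Exp T)_{jk} = δ_{jk} + Σ_{m≥1} (T^{(m)})_{jk}/m!`. -/
noncomputable def matExp (T : ℤ → ℤ → ℂ) (j k : ℤ) : ℂ :=
  (if j = k then 1 else 0) + ∑' m : ℕ, matPow T m j k / ((m + 1).factorial : ℂ)

/-- The conjugated matrix `C = Exp(−T)(G_θ + M)Exp(T)`, with entries
`C_{jk} = Σ_l (Exp(−T))_{jl}·g_θ(l)·(Exp T)_{lk} + Σ_l Σ_m (Exp(−T))_{jl}·M_{lm}·(Exp T)_{mk}`. -/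
noncomputable def conjugated (h θ : ℝ) (M T : ℤ → ℤ → ℂ) (j k : ℤ) : ℂ :=
  (∑' l : ℤ, matExp (fun a b => -T a b) j l * ((dispersion h θ l : ℝ) : ℂ) * matExp T l k)
    + ∑' l : ℤ, ∑' m : ℤ, matExp (fun a b => -T a b) j l * M l m * matExp T m k

open ComplexConjugate

/-- The anti-Hermitian matrix `v eₙ* - eₙ v*` attached to a vector `v`. -/
noncomputable def skewMatrix (n : ℤ) (v : ℤ → ℂ) (j k : ℤ) : ℂ :=
  (if k = n then v j else 0) - (if j = n then conj (v k) else 0)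

lemma skewMatrix_neg (n : ℤ) (v : ℤ → ℂ) :
    (fun a b => -skewMatrix n v a b) = skewMatrix n (-v) := by
  funext a b
  simp only [skewMatrix, Pi.neg_apply, map_neg]
  split_ifs <;> ring

lemma skewMatrix_conj (n : ℤ) (v : ℤ → ℂ) (j k : ℤ) :
    conj (skewMatrix n v j k) = -skewMatrix n v k j := by
  simp only [skewMatrix, map_sub]
  split_ifs <;> simp

/-- The square of `skewMatrix n v`, where `S = ‖v‖²`. -/
noncomputable def skewSquare (n : ℤ) (v : ℤ → ℂ) (S : ℂ) (j k : ℤ) : ℂ :=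
  -(v j * conj (v k)) - (if j = n ∧ k = n then S else 0)

lemma skewMatrix_mul_self {n : ℤ} {v : ℤ → ℂ} {S : ℂ} (hn : v n = 0)
    (hS : HasSum (fun l => conj (v l) * v l) S) (j k : ℤ) :
    ∑' l, skewMatrix n v j l * skewMatrix n v l k = skewSquare n v S j k := by
  have h1 : HasSum (fun l : ℤ => if l = n then -(v j * conj (v k)) else 0)
      (-(v j * conj (v k))) := hasSum_ite_eq n _
  have h2 := hS.mul_left (if j = n ∧ k = n then (1 : ℂ) else 0)
  convert (h1.sub h2).tsum_eq using 1
  · congr 1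
    funext l
    simp only [skewMatrix]
    by_cases hl : l = n <;> by_cases hj : j = n <;> by_cases hk : k = n <;> simp [hl, hj, hk, hn]
  · simp [skewSquare]

lemma skewSquare_mul {n : ℤ} {v : ℤ → ℂ} {S : ℂ} (hn : v n = 0)
    (hS : HasSum (fun l => conj (v l) * v l) S) (j k : ℤ) :
    ∑' l, skewSquare n v S j l * skewMatrix n v l k = -S * skewMatrix n v j k := by
  have h1 : HasSum (fun l : ℤ => if l = n then (if j = n then S * conj (v k) else 0) else 0)
      (if j = n then S * conj (v k) else 0) := hasSum_ite_eq n _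
  have h2 := hS.mul_left (if k = n then v j else 0)
  convert (h1.sub h2).tsum_eq using 1
  · congr 1
    funext l
    simp only [skewMatrix, skewSquare]
    by_cases hl : l = n <;> by_cases hj : j = n <;> by_cases hk : k = n <;>
      (simp [hl, hj, hk, hn]; try ring)
  · simp only [skewMatrix]
    split_ifs <;> ring

lemma matPow_skewMatrix {n : ℤ} {v : ℤ → ℂ} {S : ℂ} (hn : v n = 0)
    (hS : HasSum (fun l => conj (v l) * v l) S) (m : ℕ) :
    (∀ j k, matPow (skewMatrix n v) (2 * m) j k = (-S) ^ m * skewMatrix n v j k) ∧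
    (∀ j k, matPow (skewMatrix n v) (2 * m + 1) j k = (-S) ^ m * skewSquare n v S j k) := by
  have odd_of_even : ∀ m,
      (∀ j k, matPow (skewMatrix n v) (2 * m) j k = (-S) ^ m * skewMatrix n v j k) →
      (∀ j k, matPow (skewMatrix n v) (2 * m + 1) j k = (-S) ^ m * skewSquare n v S j k) := by
    intro m h j k
    simp only [matPow, h, mul_assoc, tsum_mul_left, skewMatrix_mul_self hn hS]
  induction m with
  | zero =>
    have h : ∀ j k, matPow (skewMatrix n v) (2 * 0) j k = (-S) ^ 0 * skewMatrix n v j k := by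
      simp [matPow]
    exact ⟨h, odd_of_even 0 h⟩
  | succ m ih =>
    have h : ∀ j k, matPow (skewMatrix n v) (2 * (m + 1)) j k
        = (-S) ^ (m + 1) * skewMatrix n v j k := by
      intro j k
      rw [show 2 * (m + 1) = (2 * m + 1) + 1 by ring]
      simp only [matPow] at ih ⊢
      simp only [ih.2, mul_assoc, tsum_mul_left, skewSquare_mul hn hS]
      ring
    exact ⟨h, odd_of_even (m + 1) h⟩

lemma exists_rotation_coeffs (s : ℝ) : ∃ α β : ℝ,
    HasSum (fun m : ℕ => (-s ^ 2) ^ m / ((2 * m + 1).factorial : ℝ)) α ∧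
    HasSum (fun m : ℕ => (-s ^ 2) ^ m / ((2 * m + 2).factorial : ℝ)) β ∧
    s * α = Real.sin s ∧ s ^ 2 * β = 1 - Real.cos s := by
  have key : ∀ f : ℕ → ℕ, (∀ m, m ≤ f m) →
      Summable (fun m : ℕ => (-s ^ 2) ^ m / ((f m).factorial : ℝ)) := by
    intro f hf
    refine Summable.of_norm_bounded (Real.summable_pow_div_factorial (s ^ 2)) fun m => ?_
    rw [norm_div, norm_pow, norm_neg, Real.norm_of_nonneg (sq_nonneg s), Real.norm_natCast]
    gcongr
    exact hf m
  obtain ⟨α, hα⟩ := key (fun m => 2 * m + 1) (fun m => by omega)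
  obtain ⟨β, hβ⟩ := key (fun m => 2 * m + 2) (fun m => by omega)
  refine ⟨α, β, hα, hβ, ?_, ?_⟩
  · refine (hα.mul_left s).unique
      (by
        refine (congrArg (HasSum · _) (funext fun m => ?_)).mp (Real.hasSum_sin s)
        rw [neg_pow (s ^ 2), ← pow_mul]
        ring)
  · have h := (hasSum_nat_add_iff' 1).2 (Real.hasSum_cos s)
    have h' := h.neg
    simp only [Finset.range_one, Finset.sum_singleton, mul_zero, pow_zero, Nat.factorial_zero,
      Nat.cast_one, div_one, mul_one, neg_sub] at h'
    refine (hβ.mul_left (s ^ 2)).unique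
      (by
        refine (congrArg (HasSum · _) (funext fun m => ?_)).mp h'
        rw [neg_pow (s ^ 2), ← pow_mul, show 2 * (m + 1) = 2 * m + 2 by ring]
        ring)

lemma matExp_skewMatrix {n : ℤ} {v : ℤ → ℂ} {s α β : ℝ} (hn : v n = 0)
    (hS : HasSum (fun l => conj (v l) * v l) ((s ^ 2 : ℝ) : ℂ))
    (hα : HasSum (fun m : ℕ => (-s ^ 2) ^ m / ((2 * m + 1).factorial : ℝ)) α)
    (hβ : HasSum (fun m : ℕ => (-s ^ 2) ^ m / ((2 * m + 2).factorial : ℝ)) β) (j k : ℤ) :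
    matExp (skewMatrix n v) j k = (if j = k then 1 else 0) + (α * skewMatrix n v j k
      + β * skewSquare n v ((s ^ 2 : ℝ) : ℂ) j k) := by
  rw [matExp]
  congr 1
  refine HasSum.tsum_eq (HasSum.even_add_odd ?_ ?_)
  · refine (congrArg (HasSum · _) (funext fun m => ?_)).mp
      ((Complex.hasSum_ofReal.2 hα).mul_right (skewMatrix n v j k))
    rw [(matPow_skewMatrix hn hS m).1]
    push_cast
    ring
  · refine (congrArg (HasSum · _) (funext fun m => ?_)).mp
      ((Complex.hasSum_ofReal.2 hβ).mul_right (skewSquare n v ((s ^ 2 : ℝ) : ℂ) j k))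
    rw [(matPow_skewMatrix hn hS m).2]
    push_cast
    ring

lemma skewSquare_conj (n : ℤ) (v : ℤ → ℂ) (S : ℝ) (j k : ℤ) :
    conj (skewSquare n v S j k) = skewSquare n v S k j := by
  simp only [skewSquare, map_sub, map_neg, map_mul, Complex.conj_conj, and_comm (a := j = n)]
  split_ifs <;> simp [mul_comm]

/-- The unitary `Exp(T)` rotating `eₙ` onto the line spanned by `eₙ + x`, where `x ⊥ eₙ`. -/
lemma exists_rotation {n : ℤ} {x : ℤ → ℂ} (hx : x n = 0) (hs : Summable fun l => ‖x l‖) :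
    ∃ c a B : ℝ,
      (∀ j, matExp (skewMatrix n fun l => c * x l) j n = a * (if j = n then 1 else x j)) ∧
      (∀ j, j ≠ n → ∑' l, matExp (fun a b => -skewMatrix n (fun l => c * x l) a b) j l
        * (if l = n then 1 else x l) = 0) ∧
      (∀ j l, ‖matExp (skewMatrix n fun l => c * x l) j l‖ ≤ B) ∧
      (∀ j k, conj (matExp (skewMatrix n fun l => c * x l) j k)
        = matExp (fun a b => -skewMatrix n (fun l => c * x l) a b) k j) := by
  obtain ⟨K, hK⟩ : ∃ K, ∀ l, ‖x l‖ ≤ K :=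
    ⟨_, fun l => hs.le_tsum l fun i _ => norm_nonneg (x i)⟩
  obtain ⟨S, hS⟩ : Summable fun l => ‖x l‖ ^ 2 := by
    refine Summable.of_nonneg_of_le (fun l => sq_nonneg _) (fun l => ?_) (hs.mul_left K)
    rw [sq]
    gcongr
    exact hK l
  have hS0 : 0 ≤ S := hS.nonneg fun l => sq_nonneg _
  set s := Real.arctan √S
  set c := s / √S
  obtain ⟨α, β, hα, hβ, hα', hβ'⟩ := exists_rotation_coeffs s
  have hx0 : S = 0 → ∀ j, x j = 0 := by
    rintro rfl j
    have := (hasSum_zero_iff_of_nonneg fun l => sq_nonneg ‖x l‖).1 hS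
    simpa using congrFun this j
  have hsc : s = c * √S := by
    rcases eq_or_ne (√S) 0 with h0 | h0
    · simp [s, h0]
    · exact (div_mul_cancel₀ _ h0).symm
  have hcS : c ^ 2 * S = s ^ 2 := by
    rw [hsc, mul_pow, Real.sq_sqrt hS0]
  have hαc : ∀ j, (α : ℂ) * (c * x j) = Real.cos s * x j := by
    intro j
    rcases eq_or_ne S 0 with h0 | h0
    · simp [hx0 h0]
    · have h1 : √S ≠ 0 := (Real.sqrt_ne_zero hS0).2 h0
      have h2 : α * c = Real.cos s := by
        have h3 : Real.sin s = √S * Real.cos s := by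
          rw [← Real.tan_mul_cos (Real.cos_arctan_pos _).ne', Real.tan_arctan]
        refine mul_left_cancel₀ h1 ?_
        linear_combination hα' + h3 - α * hsc
      rw [← h2]
      push_cast
      ring
  set v : ℤ → ℂ := fun l => c * x l with hv
  have hvn : v n = 0 := by simp [hv, hx]
  have hvS : HasSum (fun l => conj (v l) * v l) ((s ^ 2 : ℝ) : ℂ) := by
    rw [← hcS]
    refine (congrArg (HasSum · _) (funext fun l => ?_)).mp
      (Complex.hasSum_ofReal.2 (hS.mul_left (c ^ 2)))
    simp only [hv, map_mul, Complex.conj_ofReal]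
    push_cast
    rw [← Complex.conj_mul']
    ring
  have hwS : HasSum (fun l => conj ((-v) l) * (-v) l) ((s ^ 2 : ℝ) : ℂ) := by
    simpa using hvS
  have hexp := matExp_skewMatrix hvn hvS hα hβ
  have hexp' := matExp_skewMatrix (by simp [hvn] : (-v) n = 0) hwS hα hβ
  have hβc : (β : ℂ) * ((s ^ 2 : ℝ) : ℂ) = 1 - Real.cos s := by
    rw [← Complex.ofReal_one, ← Complex.ofReal_sub, ← hβ']
    push_cast
    ring
  refine ⟨c, Real.cos s, 1 + (|α| * (|c| * K + |c| * K)
    + |β| * (|c| * K * (|c| * K) + s ^ 2)), ?_, ?_, ?_, ?_⟩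
  · intro j
    rw [hexp]
    by_cases hj : j = n
    · simp only [hj, skewMatrix, skewSquare, hvn]
      simp only [if_true, and_self, map_zero, mul_zero, sub_zero, neg_zero, zero_sub, zero_add]
      linear_combination -hβc
    · simp only [hj, skewMatrix, skewSquare, hvn]
      simp only [if_true, if_false, map_zero, mul_zero, sub_zero, neg_zero, zero_add,
        add_zero, false_and]
      exact hαc j
  · intro j hj
    rw [skewMatrix_neg]
    have h1 : HasSum (fun l : ℤ => if l = j then x j else 0) (x j) := hasSum_ite_eq j _
    have h2 : HasSum (fun l : ℤ => if l = n then -(α * v j) else 0) (-(α * v j)) :=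
      hasSum_ite_eq n _
    have h3 := (Complex.hasSum_ofReal.2 hS).mul_left (-(β * v j * c))
    have h4 := (h1.add h2).add h3
    have h5 : x j + -(α * v j) + -(β * v j * c) * (S : ℂ) = 0 := by
      have h6 : (c : ℂ) ^ 2 * S = ((s ^ 2 : ℝ) : ℂ) := by rw [← hcS]; push_cast; ring
      simp only [hv, hαc j]
      linear_combination (-(β : ℂ) * x j) * h6 - x j * hβc
    rw [h5] at h4
    refine HasSum.tsum_eq ((congrArg (HasSum · _) (funext fun l => ?_)).mp h4)
    rw [hexp']
    push_cast
    rw [← Complex.conj_mul']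
    by_cases hl : l = n
    · simp [hl, hj, Ne.symm hj, skewMatrix, skewSquare, hvn, hx]
    · by_cases hlj : l = j
      · subst hlj
        simp [hl, skewMatrix, skewSquare, hv]
        ring
      · simp [hl, hlj, Ne.symm hlj, hj, skewMatrix, skewSquare, hv]
        ring
  · intro j l
    have hvK : ∀ l, ‖v l‖ ≤ |c| * K := by
      intro l
      rw [hv, norm_mul, Complex.norm_real, Real.norm_eq_abs]
      gcongr
      exact hK l
    have hK0 : 0 ≤ |c| * K := (norm_nonneg _).trans (hvK 0)
    rw [hexp]
    refine (norm_add_le _ _).trans (add_le_add ?_ ((norm_add_le _ _).trans (add_le_add ?_ ?_)))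
    · split_ifs <;> simp
    · rw [norm_mul, Complex.norm_real, Real.norm_eq_abs]
      gcongr
      refine (norm_sub_le _ _).trans (add_le_add ?_ ?_) <;> split_ifs <;> simp [hvK, hK0]
    · rw [norm_mul, Complex.norm_real, Real.norm_eq_abs]
      gcongr
      refine (norm_sub_le _ _).trans (add_le_add ?_ ?_)
      · rw [norm_neg, norm_mul, RCLike.norm_conj]
        exact mul_le_mul (hvK _) (hvK _) (norm_nonneg _) hK0
      · split_ifs
        · rw [Complex.norm_real, Real.norm_of_nonneg (sq_nonneg s)]
        · simpa using sq_nonneg s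
  · intro j k
    rw [skewMatrix_neg, hexp, hexp', ← skewMatrix_neg]
    simp only [map_add, map_mul, Complex.conj_ofReal, skewMatrix_conj, skewSquare_conj]
    congr 1
    · simp only [eq_comm (a := j)]
      split_ifs <;> simp
    · congr 2
      simp [skewSquare]

/-- If `Exp(T)eₙ` is an eigenvector of the Hermitian operator `G + M`, then the conjugated
matrix decouples the mode `n`. -/
lemma conjugated_eq_zero {h θ a B : ℝ} {n : ℤ} {M T : ℤ → ℤ → ℂ} {u : ℤ → ℂ} {μ : ℂ}
    (hM : ∀ j l, M j l = conj (M l j)) (hu : Summable fun l => ‖u l‖)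
    (hMu : Summable fun p : ℤ × ℤ => ‖M p.1 p.2‖ * ‖u p.2‖)
    (heig : ∀ l, ∑' m, M l m * u m = (μ - dispersion h θ l) * u l)
    (hcol : ∀ j, matExp T j n = a * u j)
    (hker : ∀ j, j ≠ n → ∑' l, matExp (fun a b => -T a b) j l * u l = 0)
    (hB : ∀ j l, ‖matExp T j l‖ ≤ B)
    (hconj : ∀ j k, conj (matExp T j k) = matExp (fun a b => -T a b) k j) :
    (∀ j, j ≠ n → conjugated h θ M T j n = 0) ∧
      (∀ k, k ≠ n → conjugated h θ M T n k = 0) := by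
  have hB' : ∀ j l, ‖matExp (fun a b => -T a b) j l‖ ≤ B := fun j l => by
    rw [← hconj, RCLike.norm_conj]
    exact hB l j
  have hMsum : Summable fun l => ‖∑' m, M l m * u m‖ := by
    refine Summable.of_nonneg_of_le (fun _ => norm_nonneg _) (fun l => ?_) hMu.prod
    simpa only [norm_mul] using norm_tsum_le_tsum_norm (f := fun m => M l m * u m)
      (by simpa only [norm_mul] using hMu.prod_factor l)
  have hcolumn : ∀ j, j ≠ n → conjugated h θ M T j n = 0 := by
    intro j hj
    have hs1 : Summable fun l => matExp (fun a b => -T a b) j l * u l := by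
      refine .of_norm_bounded (hu.mul_left B) fun l => ?_
      rw [norm_mul]
      gcongr
      exact hB' j l
    have hs2 : Summable fun l => matExp (fun a b => -T a b) j l
        * ((μ - dispersion h θ l) * u l) := by
      refine .of_norm_bounded (hMsum.mul_left B) fun l => ?_
      rw [norm_mul, heig]
      gcongr
      exact hB' j l
    have h1 := (hs1.hasSum.mul_left μ).sub hs2.hasSum
    rw [conjugated]
    have e1 : ∀ l, matExp (fun a b => -T a b) j l * ((dispersion h θ l : ℝ) : ℂ) * matExp T l n
        = a * (μ * (matExp (fun a b => -T a b) j l * u l)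
          - matExp (fun a b => -T a b) j l * ((μ - dispersion h θ l) * u l)) := fun l => by
      rw [hcol]; ring
    have e2 : ∀ l, ∑' m, matExp (fun a b => -T a b) j l * M l m * matExp T m n
        = a * (matExp (fun a b => -T a b) j l * ((μ - dispersion h θ l) * u l)) := fun l => by
      rw [← heig, ← tsum_mul_left, ← tsum_mul_left]
      exact tsum_congr fun m => by rw [hcol]; ring
    simp only [e1, e2]
    rw [(h1.mul_left (a : ℂ)).tsum_eq, (hs2.hasSum.mul_left (a : ℂ)).tsum_eq, ← mul_add,
      sub_add_cancel, hker j hj, mul_zero, mul_zero]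
  refine ⟨hcolumn, fun k hk => ?_⟩
  have hconj' : ∀ j k, conj (matExp (fun a b => -T a b) j k) = matExp T k j := fun j k => by
    rw [← hconj, Complex.conj_conj]
  suffices conjugated h θ M T n k = conj (conjugated h θ M T k n) by
    rw [this, hcolumn k hk, map_zero]
  rw [conjugated, conjugated, map_add, Complex.conj_tsum, Complex.conj_tsum]
  congr 1
  · refine tsum_congr fun l => ?_
    rw [map_mul, map_mul, hconj, hconj', Complex.conj_ofReal]
    ring
  · rw [Summable.tsum_comm]
    · refine tsum_congr fun l => ?_
      rw [Complex.conj_tsum]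
      refine tsum_congr fun m => ?_
      rw [map_mul, map_mul, hconj, hconj', ← hM]
      ring
    · refine .of_norm_bounded ((hMu.mul_left |a|).mul_right B) fun p => ?_
      simp only [Function.uncurry]
      rw [norm_mul, norm_mul, ← hconj, RCLike.norm_conj, hcol, norm_mul, Complex.norm_real,
        Real.norm_eq_abs, hM p.2 p.1, RCLike.norm_conj]
      have h0 : 0 ≤ |a| * ‖u p.2‖ * ‖M p.1 p.2‖ := by positivity
      exact (mul_le_mul_of_nonneg_left (hB _ _) h0).trans_eq (by ring)

local notation "ℓ₁" => lp (fun _ : ℤ => ℂ) 1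

lemma lp_one_enorm (f : ℓ₁) : ‖f‖ₑ = ∑' i, ‖f i‖ₑ := by
  have h : HasSum (fun i => ‖f i‖) ‖f‖ := by
    simpa using lp.hasSum_norm (by simp : (0 : ℝ) < (1 : ℝ≥0∞).toReal) f
  rw [← ofReal_norm, ← h.tsum_eq,
    ENNReal.ofReal_tsum_of_nonneg (fun i => norm_nonneg _) h.summable]
  simp only [ofReal_norm]

lemma memlp_one_of_tsum_enorm_ne_top {f : ℤ → ℂ} (h : ∑' i, ‖f i‖ₑ ≠ ⊤) :
    Memℓp (E := fun _ : ℤ => ℂ) f 1 :=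
  (memℓp_gen_iff (by simp)).2 (by simpa using tsum_enorm_ne_top_iff_summable_norm.1 h)

/-- An infinite matrix with uniformly summable columns acts boundedly on `ℓ¹`. -/
lemma exists_lp_one_clm (A : ℤ → ℤ → ℂ) {C : ℝ} (hC : 0 ≤ C)
    (hA : ∀ l, ∑' j, ‖A j l‖ₑ ≤ ENNReal.ofReal C) :
    ∃ L : ℓ₁ →L[ℂ] ℓ₁, ‖L‖ ≤ C ∧ ∀ (f : ℓ₁) (j : ℤ), L f j = ∑' l, A j l * f l := by
  have hbound : ∀ f : ℓ₁, ∑' j, ∑' l, ‖A j l * f l‖ₑ ≤ ENNReal.ofReal C * ‖f‖ₑ := by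
    intro f
    rw [ENNReal.tsum_comm, lp_one_enorm, ← ENNReal.tsum_mul_left]
    refine ENNReal.tsum_le_tsum fun l => ?_
    simp only [enorm_mul, ENNReal.tsum_mul_right]
    gcongr
    exact hA l
  have hfin : ∀ f : ℓ₁, ∑' j, ∑' l, ‖A j l * f l‖ₑ ≠ ⊤ := fun f =>
    ((hbound f).trans_lt (ENNReal.mul_lt_top ENNReal.ofReal_lt_top enorm_lt_top)).ne
  have hrow : ∀ (f : ℓ₁) (j : ℤ), Summable fun l => A j l * f l := fun f j =>
    .of_enorm (ENNReal.ne_top_of_tsum_ne_top (hfin f) j)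
  have hle : ∀ f : ℓ₁, ∑' j, ‖∑' l, A j l * f l‖ₑ ≤ ENNReal.ofReal C * ‖f‖ₑ := fun f =>
    (ENNReal.tsum_le_tsum fun j => enorm_tsum_le_tsum_enorm).trans (hbound f)
  have hmem : ∀ f : ℓ₁, Memℓp (E := fun _ : ℤ => ℂ) (fun j => ∑' l, A j l * f l) 1 := fun f =>
    memlp_one_of_tsum_enorm_ne_top
      ((hle f).trans_lt (ENNReal.mul_lt_top ENNReal.ofReal_lt_top enorm_lt_top)).ne
  let L : ℓ₁ →ₗ[ℂ] ℓ₁ :=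
    { toFun := fun f => ⟨fun j => ∑' l, A j l * f l, hmem f⟩
      map_add' := fun f g => by
        ext j
        simp only [lp.coeFn_add, Pi.add_apply, mul_add]
        exact (hrow f j).tsum_add (hrow g j)
      map_smul' := fun c f => by
        ext j
        simp only [lp.coeFn_smul, Pi.smul_apply, smul_eq_mul, RingHom.id_apply, ← tsum_mul_left]
        exact tsum_congr fun l => by ring }
  have hL : ∀ f, ‖L f‖ ≤ C * ‖f‖ := by
    intro f
    have h : ‖L f‖ₑ ≤ ENNReal.ofReal C * ‖f‖ₑ := (lp_one_enorm (L f)).trans_le (hle f)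
    rwa [← ofReal_norm, ← ofReal_norm, ← ENNReal.ofReal_mul hC,
      ENNReal.ofReal_le_ofReal_iff (by positivity)] at h
  exact ⟨L.mkContinuous C hL, L.mkContinuous_norm_le hC hL, fun f j => rfl⟩

/-- The fixed-point equation for the correction to the unperturbed eigenvector. -/
lemma exists_fixedPoint (A D : ℓ₁ →L[ℂ] ℓ₁) (e : ℓ₁) (he : ‖e‖ = 1) (n : ℤ)
    (h : ‖D‖ * ‖A‖ ≤ 1 / 8) : ∃ y : ℓ₁, y = D (A (e + y) - (A (e + y)) n • y) := by
  set F : ℓ₁ → ℓ₁ := fun y => D (A (e + y) - (A (e + y)) n • y) with hF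
  have hAle : ∀ z : ℓ₁, ‖(A z) n‖ ≤ ‖A‖ * ‖z‖ := fun z =>
    (lp.norm_apply_le_norm one_ne_zero _ n).trans (A.le_opNorm z)
  have hsum : ∀ y ∈ Metric.closedBall (0 : ℓ₁) 1, ‖e + y‖ ≤ 2 := by
    intro y hy
    rw [mem_closedBall_zero_iff] at hy
    linarith [norm_add_le e y]
  have hmaps : Set.MapsTo F (Metric.closedBall 0 1) (Metric.closedBall 0 1) := by
    intro y hy
    have h2 := hsum y hy
    rw [mem_closedBall_zero_iff] at hy ⊢
    calc ‖F y‖ ≤ ‖D‖ * ‖A (e + y) - (A (e + y)) n • y‖ := D.le_opNorm _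
      _ ≤ ‖D‖ * (‖A‖ * 2 + ‖A‖ * 2 * 1) := by
        gcongr
        refine (norm_sub_le _ _).trans (add_le_add ((A.le_opNorm _).trans (by gcongr)) ?_)
        rw [norm_smul]
        gcongr
        exact (hAle _).trans (by gcongr)
      _ = 4 * (‖D‖ * ‖A‖) := by ring
      _ ≤ 1 := by linarith
  have hlip : ∀ y ∈ Metric.closedBall (0 : ℓ₁) 1, ∀ z ∈ Metric.closedBall (0 : ℓ₁) 1,
      dist (F y) (F z) ≤ 1 / 2 * dist y z := by
    intro y hy z hz
    have h2 := hsum y hy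
    rw [mem_closedBall_zero_iff] at hz
    have e1 : F y - F z = D (A (y - z) - (A (e + y)) n • (y - z) - (A (y - z)) n • z) := by
      have h3 : (A (y - z)) n = (A (e + y)) n - (A (e + z)) n := by
        rw [← Pi.sub_apply, ← lp.coeFn_sub, ← map_sub]
        abel_nf
      rw [hF, ← map_sub, h3]
      congr 1
      rw [show y - z = (e + y) - (e + z) by abel, map_sub, sub_smul,
        show (e + y) - (e + z) = y - z by abel, smul_sub]
      abel
    rw [dist_eq_norm, dist_eq_norm, e1]
    calc _ ≤ ‖D‖ * ‖A (y - z) - (A (e + y)) n • (y - z) - (A (y - z)) n • z‖ := D.le_opNorm _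
      _ ≤ ‖D‖ * (‖A‖ * ‖y - z‖ + ‖A‖ * 2 * ‖y - z‖ + ‖A‖ * ‖y - z‖ * 1) := by
        gcongr
        refine (norm_sub_le _ _).trans (add_le_add ((norm_sub_le _ _).trans
          (add_le_add (A.le_opNorm _) ?_)) ?_) <;> rw [norm_smul] <;> gcongr
        · exact (hAle _).trans (by gcongr)
        · exact hAle _
      _ = 4 * (‖D‖ * ‖A‖) * ‖y - z‖ := by ring
      _ ≤ 1 / 2 * ‖y - z‖ := by gcongr; linarith
  have hcontr : ContractingWith (1 / 2) (hmaps.restrict F _ _) :=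
    ⟨by norm_num, LipschitzWith.of_dist_le_mul fun y z => by
      simpa [Subtype.dist_eq] using hlip y y.2 z z.2⟩
  obtain ⟨y, -, hy, -⟩ := ContractingWith.exists_fixedPoint'
    Metric.isClosed_closedBall.isComplete hmaps hcontr
    (Metric.mem_closedBall_self zero_le_one) (edist_ne_top _ _)
  exact ⟨y, hy.symm⟩

lemma tanh_monotone : Monotone Real.tanh := by
  intro x y hxy
  rw [Real.tanh_eq_sinh_div_cosh, Real.tanh_eq_sinh_div_cosh,
    div_le_div_iff₀ (Real.cosh_pos _) (Real.cosh_pos _)]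
  have h := Real.sinh_nonneg_iff.2 (sub_nonneg.2 hxy)
  rw [Real.sinh_sub] at h
  linarith

lemma tanh_pos {x : ℝ} (hx : 0 < x) : 0 < Real.tanh x := by
  rw [Real.tanh_eq_sinh_div_cosh]
  exact div_pos (Real.sinh_pos_iff.2 hx) (Real.cosh_pos _)

lemma mul_tanh_gap {h x y : ℝ} (hh : 0 < h) (hx : 0 ≤ x) (hxy : x + 1 / 4 ≤ y) :
    1 / 4 * Real.tanh (h / 4) ≤ y * Real.tanh (h * y) - x * Real.tanh (h * x) := by
  have h1 : Real.tanh (h * x) ≤ Real.tanh (h * y) := tanh_monotone (by gcongr; linarith)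
  have h2 : Real.tanh (h / 4) ≤ Real.tanh (h * y) := tanh_monotone (by nlinarith)
  have h3 : 0 < Real.tanh (h / 4) := tanh_pos (by positivity)
  nlinarith [mul_le_mul_of_nonneg_left h1 hx]

lemma dispersion_eq_abs (h θ : ℝ) (k : ℤ) :
    dispersion h θ k = |(k : ℝ) + θ| * Real.tanh (h * |(k : ℝ) + θ|) := by
  rw [dispersion]
  rcases abs_cases ((k : ℝ) + θ) with ⟨h', -⟩ | ⟨h', -⟩ <;> rw [h']
  rw [mul_neg, Real.tanh_neg, neg_mul_neg]

lemma dispersion_gap {h θ : ℝ} (hh : 0 < h) (hθ₁ : 1 / 8 < θ) (hθ₂ : θ < 3 / 8) {j k : ℤ}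
    (hjk : j ≠ k) : 1 / 4 * Real.tanh (h / 4) ≤ |dispersion h θ j - dispersion h θ k| := by
  have hsep : |(j : ℝ) + θ| + 1 / 4 ≤ |(k : ℝ) + θ| ∨ |(k : ℝ) + θ| + 1 / 4 ≤ |(j : ℝ) + θ| := by
    have key : ∀ m : ℤ, (m : ℝ) ≤ -1 ∨ (0 : ℝ) ≤ m := fun m => by
      rcases lt_or_ge m 0 with hm | hm
      · left; exact_mod_cast (by omega : m ≤ -1)
      · right; exact_mod_cast hm
    have hne : (j : ℝ) + 1 ≤ k ∨ (k : ℝ) + 1 ≤ j := by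
      rcases lt_or_gt_of_ne hjk with hm | hm
      · left; exact_mod_cast hm
      · right; exact_mod_cast hm
    have h1 := key (j + k)
    push_cast at h1
    rcases abs_cases ((j : ℝ) + θ) with ⟨hj, -⟩ | ⟨hj, -⟩ <;>
      rcases abs_cases ((k : ℝ) + θ) with ⟨hk, -⟩ | ⟨hk, -⟩ <;>
      rcases h1 with h1 | h1 <;> rcases hne with hne | hne <;> rw [hj, hk] <;>
      first
      | (left; linarith)
      | (right; linarith)
  rw [dispersion_eq_abs, dispersion_eq_abs]
  rcases hsep with hs | hs
  · rw [abs_sub_comm]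
    exact (mul_tanh_gap hh (abs_nonneg _) hs).trans (le_abs_self _)
  · exact (mul_tanh_gap hh (abs_nonneg _) hs).trans (le_abs_self _)

lemma bracket_pos (m : ℤ) : 0 < bracket m := Real.sqrt_pos.2 (by positivity)

lemma bracket_neg (m : ℤ) : bracket (-m) = bracket m := by simp [bracket]

lemma bracket_zero_le (m : ℤ) : bracket 0 ≤ bracket m :=
  Real.sqrt_le_sqrt (by simp; positivity)

lemma bracket_add_le (a b : ℤ) : bracket (a + b) ≤ bracket a * bracket b := by
  rw [bracket, bracket, bracket, ← Real.sqrt_mul (by positivity)]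
  refine Real.sqrt_le_sqrt ?_
  push_cast
  nlinarith [sq_nonneg ((a : ℝ) - b), mul_nonneg (sq_nonneg (a : ℝ)) (sq_nonneg (b : ℝ))]

lemma one_le_bracket (m : ℤ) : 1 ≤ bracket m :=
  Real.one_le_sqrt.2 (by nlinarith [sq_nonneg (m : ℝ)])

/-- The weight `⟨j - n⟩ʳ`, normalised to be `1` at `j = n`. -/
noncomputable def weight (r : ℝ) (n j : ℤ) : ℝ := (bracket (j - n) / bracket 0) ^ r

lemma weight_pos (r : ℝ) (n j : ℤ) : 0 < weight r n j :=
  Real.rpow_pos_of_pos (div_pos (bracket_pos _) (bracket_pos _)) _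

lemma weight_self (r : ℝ) (n : ℤ) : weight r n n = 1 := by
  rw [weight, sub_self, div_self (bracket_pos 0).ne', Real.one_rpow]

lemma one_le_weight {r : ℝ} (hr : 0 ≤ r) (n j : ℤ) : 1 ≤ weight r n j :=
  Real.one_le_rpow ((one_le_div (bracket_pos 0)).2 (bracket_zero_le _)) hr

lemma weight_le_mul {r : ℝ} (hr : 0 ≤ r) (n j l : ℤ) :
    weight r n j ≤ bracket (j - l) ^ r * weight r n l := by
  have h1 := (bracket_pos (j - l)).le
  have h2 := (bracket_pos (l - n)).le
  have h3 := bracket_pos 0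
  rw [weight, weight, ← Real.mul_rpow h1 (by positivity), ← mul_div_assoc]
  refine Real.rpow_le_rpow (div_nonneg (bracket_pos _).le h3.le) ?_ hr
  gcongr
  simpa using bracket_add_le (j - l) (l - n)

lemma bracket_rpow_eq (r : ℝ) (n j : ℤ) :
    bracket (j - n) ^ r = bracket 0 ^ r * weight r n j := by
  have h2 := (bracket_pos (j - n)).le
  have h3 := bracket_pos 0
  rw [weight, ← Real.mul_rpow h3.le (by positivity), mul_div_cancel₀ _ h3.ne']

/-- A sufficiently small perturbation has an eigenvector close to `eₙ` in weighted `ℓ¹`. -/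
lemma exists_eigenvector {h r θ : ℝ} (hh : 0 < h) (hr : 0 ≤ r) (n : ℤ)
    (hθ₁ : 1 / 8 < θ) (hθ₂ : θ < 3 / 8) {M : ℤ → ℤ → ℂ}
    (hM : ∀ l, ∑' j, ‖M j l‖ₑ * ENNReal.ofReal (bracket (j - l) ^ r)
      ≤ ENNReal.ofReal (1 / 4 * Real.tanh (h / 4) / 8)) :
    ∃ (x : ℤ → ℂ) (μ : ℂ), x n = 0 ∧ Summable (fun l => ‖x l‖ * weight r n l) ∧
      (Summable fun p : ℤ × ℤ => ‖M p.1 p.2‖ * ‖if p.2 = n then 1 else x p.2‖) ∧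
      ∀ l, ∑' m, M l m * (if m = n then 1 else x m)
        = (μ - dispersion h θ l) * (if l = n then 1 else x l) := by
  set δ := 1 / 4 * Real.tanh (h / 4)
  have hδ : 0 < δ := mul_pos (by norm_num) (tanh_pos (by positivity))
  have hWc : ∀ j, (weight r n j : ℂ) ≠ 0 := fun j => by exact_mod_cast (weight_pos r n j).ne'
  obtain ⟨A, hA, hA'⟩ := exists_lp_one_clm
    (fun j l => M j l * ((weight r n j / weight r n l : ℝ) : ℂ)) (by positivity : 0 ≤ δ / 8) (by
      intro l
      refine (ENNReal.tsum_le_tsum fun j => ?_).trans (hM l)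
      rw [enorm_mul]
      gcongr
      rw [← ofReal_norm, Complex.norm_real,
        Real.norm_of_nonneg (div_nonneg (weight_pos r n j).le (weight_pos r n l).le)]
      exact ENNReal.ofReal_le_ofReal
        ((div_le_iff₀ (weight_pos r n l)).2 (weight_le_mul hr n j l)))
  obtain ⟨D, hD, hD'⟩ := exists_lp_one_clm
    (fun j l => if l = j then (((dispersion h θ n - dispersion h θ j)⁻¹ : ℝ) : ℂ) else 0)
    (by positivity : 0 ≤ δ⁻¹) (by
      intro l
      rw [tsum_eq_single l fun j hj => by simp [Ne.symm hj]]
      simp only [if_true]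
      rw [← ofReal_norm, Complex.norm_real, norm_inv, Real.norm_eq_abs]
      refine ENNReal.ofReal_le_ofReal ?_
      by_cases hl : l = n
      · simpa [hl] using hδ.le
      · exact inv_anti₀ hδ (dispersion_gap hh hθ₁ hθ₂ (Ne.symm hl)))
  set e : ℓ₁ := lp.single 1 n 1
  have he : ‖e‖ = 1 := by simp [e, lp.norm_single]
  have hen : ∀ j, e j = if j = n then 1 else 0 := fun j => by
    simp [e, lp.single_apply, Pi.single_apply]
  obtain ⟨y, hy⟩ := exists_fixedPoint A D e he n (by
    calc ‖D‖ * ‖A‖ ≤ δ⁻¹ * (δ / 8) := by gcongr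
      _ = 1 / 8 := by field_simp)
  set ν := (A (e + y)) n
  have hyj : ∀ j, y j = (((dispersion h θ n - dispersion h θ j)⁻¹ : ℝ) : ℂ)
      * ((A (e + y)) j - ν * y j) := by
    intro j
    conv_lhs => rw [hy]
    rw [hD', tsum_eq_single j fun l hl => by simp [hl], if_pos rfl]
    rfl
  have hyn : y n = 0 := by simpa using hyj n
  have hAz : ∀ j, (A (e + y)) j
      = (dispersion h θ n + ν - dispersion h θ j) * (e j + y j) := by
    intro j
    by_cases hj : j = n
    · subst hj
      rw [hen, hyn]
      simp [ν]
    · have hg : dispersion h θ n - dispersion h θ j ≠ 0 := fun h0 => by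
        have := dispersion_gap hh hθ₁ hθ₂ (Ne.symm hj)
        rw [h0, abs_zero] at this
        exact this.not_gt hδ
      have hg' : ((dispersion h θ n : ℂ) - dispersion h θ j) ≠ 0 := by exact_mod_cast hg
      have h1 := hyj j
      push_cast at h1
      rw [eq_inv_mul_iff_mul_eq₀ hg'] at h1
      rw [hen, if_neg hj]
      linear_combination -h1
  have hu : ∀ l, (if l = n then 1 else y l / weight r n l) = (e l + y l) / weight r n l := by
    intro l
    rw [hen]
    by_cases hl : l = n
    · subst hl; simp [hyn, weight_self]
    · simp [hl]
  have hyS : Summable fun l => ‖y l‖ := by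
    simpa using (lp.hasSum_norm (by simp : (0 : ℝ) < (1 : ℝ≥0∞).toReal) y).summable
  have hz : ∑' l, ‖(e + y) l‖ₑ ≠ ⊤ := by
    rw [← lp_one_enorm]
    exact enorm_ne_top
  refine ⟨fun l => y l / weight r n l, dispersion h θ n + ν, by simp [hyn], ?_, ?_, ?_⟩
  · convert hyS using 2 with l
    rw [norm_div, Complex.norm_real, Real.norm_of_nonneg (weight_pos r n l).le,
      div_mul_cancel₀ _ (weight_pos r n l).ne']
  · have key : ∑' p : ℤ × ℤ, ‖M p.1 p.2 * ((e + y) p.2 / weight r n p.2)‖ₑ ≠ ⊤ := by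
      refine ne_top_of_le_ne_top
        (ENNReal.mul_ne_top (ENNReal.ofReal_ne_top (r := δ / 8)) hz) ?_
      rw [ENNReal.tsum_prod (f := fun j l => ‖M j l * ((e + y) l / weight r n l)‖ₑ),
        ENNReal.tsum_comm, ← ENNReal.tsum_mul_left]
      refine ENNReal.tsum_le_tsum fun l => ?_
      simp only [enorm_mul, ENNReal.tsum_mul_right]
      gcongr
      · refine (ENNReal.tsum_le_tsum fun j => ?_).trans (hM l)
        refine le_mul_of_one_le_right' ?_
        rw [ENNReal.one_le_ofReal]
        exact Real.one_le_rpow (one_le_bracket _) hr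
      · rw [enorm_le_iff_norm_le, norm_div, Complex.norm_real,
          Real.norm_of_nonneg (weight_pos r n l).le]
        exact div_le_self (norm_nonneg _) (one_le_weight hr n l)
    have := tsum_enorm_ne_top_iff_summable_norm.1 key
    simp only [hu]
    simpa only [norm_mul, lp.coeFn_add, Pi.add_apply] using this
  · intro l
    simp only [hu]
    rw [← mul_div_assoc, ← hAz, hA', eq_div_iff (hWc l), ← tsum_mul_right]
    refine tsum_congr fun m => ?_
    have := hWc m
    simp only [lp.coeFn_add, Pi.add_apply]
    push_cast
    field_simp

lemma skewMatrix_norm_lt_top {r : ℝ} {n : ℤ} {v : ℤ → ℂ}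
    (hv : Summable fun l => ‖v l‖ * weight r n l) :
    (⨆ j : ℤ, ∑' l : ℤ, (‖skewMatrix n v j l‖₊ : ℝ≥0∞)
      * ENNReal.ofReal (bracket (j - l) ^ r)) < ⊤ := by
  have hsymm : ∀ l, bracket (n - l) = bracket (l - n) := fun l => by rw [← bracket_neg, neg_sub]
  set K := ∑' l, ‖v l‖ₑ * ENNReal.ofReal (bracket (l - n) ^ r)
  have hKtop : K ≠ ⊤ := by
    have h1 : Summable fun l => ‖((‖v l‖ * bracket (l - n) ^ r : ℝ))‖ := by
      refine (hv.mul_left (bracket 0 ^ r)).norm.congr fun l => ?_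
      rw [bracket_rpow_eq]
      congr 1
      ring
    convert tsum_enorm_ne_top_iff_summable_norm.2 h1 using 3 with l
    rw [enorm_mul, enorm_norm, Real.enorm_of_nonneg (Real.rpow_nonneg (bracket_pos _).le _)]
  refine lt_of_le_of_lt (iSup_le fun j => ?_)
    (ENNReal.add_lt_top.2 ⟨hKtop.lt_top, hKtop.lt_top⟩)
  have hterm : ∀ l, (‖skewMatrix n v j l‖₊ : ℝ≥0∞) * ENNReal.ofReal (bracket (j - l) ^ r)
      ≤ (if l = n then ‖v j‖ₑ * ENNReal.ofReal (bracket (j - n) ^ r) else 0)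
        + ‖v l‖ₑ * ENNReal.ofReal (bracket (l - n) ^ r) := by
    intro l
    change ‖skewMatrix n v j l‖ₑ * _ ≤ _
    refine (mul_le_mul_left (enorm_sub_le) _).trans ?_
    rw [add_mul]
    refine add_le_add ?_ ?_
    · split_ifs with h1
      · rw [h1]
      · simp
    · split_ifs with h1
      · rw [h1, hsymm, ← ofReal_norm, RCLike.norm_conj, ofReal_norm]
      · simp
  refine (ENNReal.tsum_le_tsum hterm).trans ?_
  rw [ENNReal.tsum_add, tsum_ite_eq]
  gcongr
  exact ENNReal.le_tsum (f := fun l => ‖v l‖ₑ * ENNReal.ofReal (bracket (l - n) ^ r)) j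

/-- Simple-eigenspace perturbation: for `h > 0`, `r ≥ 1`, `n ∈ ℤ` and `θ ∈ (1/8, 3/8)`,
there is `ρ > 0` such that for every Hermitian matrix `M` with `‖M‖_r < ρ`, there is an
anti-Hermitian matrix `T`, supported where exactly one index equals `n` and with finite
`r`-norm, such that the conjugated matrix `Exp(−T)(G_θ + M)Exp(T)` has vanishing
off-diagonal entries on the `n`-th row and column. -/
theorem simple_eigenspace_perturbation
    (h r : ℝ) (hh : 0 < h) (hr : 1 ≤ r) (n : ℤ)
    (θ : ℝ) (hθ₁ : 1 / 8 < θ) (hθ₂ : θ < 3 / 8) :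
    ∃ ρ : ℝ, 0 < ρ ∧
      ∀ M : ℤ → ℤ → ℂ, (∀ j l : ℤ, M j l = starRingEnd ℂ (M l j)) →
        (⨆ j : ℤ, ∑' l : ℤ, (‖M j l‖₊ : ℝ≥0∞) * ENNReal.ofReal (bracket (j - l) ^ r))
          < ENNReal.ofReal ρ →
        ∃ T : ℤ → ℤ → ℂ,
          (∀ j k : ℤ, T j k = -starRingEnd ℂ (T k j)) ∧
          (∀ j k : ℤ, ¬((j = n ∧ k ≠ n) ∨ (j ≠ n ∧ k = n)) → T j k = 0) ∧
          (⨆ j : ℤ, ∑' l : ℤ, (‖T j l‖₊ : ℝ≥0∞) * ENNReal.ofReal (bracket (j - l) ^ r))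
            < ⊤ ∧
          (∀ j : ℤ, j ≠ n → conjugated h θ M T j n = 0) ∧
          (∀ k : ℤ, k ≠ n → conjugated h θ M T n k = 0) := by
  have hr0 : 0 ≤ r := zero_le_one.trans hr
  refine ⟨1 / 4 * Real.tanh (h / 4) / 8,
    div_pos (mul_pos (by norm_num) (tanh_pos (by positivity))) (by norm_num), fun M hM hsmall => ?_⟩
  obtain ⟨x, μ, hxn, hxS, hMu, heig⟩ := exists_eigenvector hh hr0 n hθ₁ hθ₂ (M := M) (by
    intro l
    refine le_trans (le_of_eq ?_)
      ((le_iSup (fun j : ℤ => ∑' l : ℤ, (‖M j l‖₊ : ℝ≥0∞)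
        * ENNReal.ofReal (bracket (j - l) ^ r)) l).trans hsmall.le)
    refine tsum_congr fun j => ?_
    rw [hM j l, ← bracket_neg, neg_sub, ← ofReal_norm, RCLike.norm_conj, ofReal_norm]
    rfl)
  have hxs : Summable fun l => ‖x l‖ :=
    Summable.of_nonneg_of_le (fun _ => norm_nonneg _)
      (fun l => le_mul_of_one_le_right (norm_nonneg _) (one_le_weight hr0 n l)) hxS
  have hus : Summable fun l => ‖if l = n then 1 else x l‖ := by
    refine Summable.of_nonneg_of_le (fun _ => norm_nonneg _) (fun l => ?_)
      ((hasSum_ite_eq n (1 : ℝ)).summable.add hxs)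
    split_ifs <;> simp
  obtain ⟨c, a, B, hcol, hker, hB, hconj⟩ := exists_rotation hxn hxs
  refine ⟨skewMatrix n fun l => c * x l, fun j k => ?_, fun j k hjk => ?_,
    skewMatrix_norm_lt_top ?_, conjugated_eq_zero hM hus hMu heig hcol hker hB hconj⟩
  · rw [skewMatrix_conj, neg_neg]
  · by_cases hj : j = n <;> by_cases hk : k = n <;>
      simp [hj, hk, hxn, skewMatrix] at hjk ⊢
  · refine (hxS.mul_left |c|).congr fun l => ?_
    rw [norm_mul, Complex.norm_real, Real.norm_eq_abs, mul_assoc]
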